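/- arXiv:1408.1585 — 2 statements merged into one kernel-verified Lean document; each statement's English description precedes it below -/
import Mathlib

section
/- Let 𝓑 be an asymptotic gauge on a set of indices 𝕀 = (I, ≤, 𝓘). Then ℝ_M(𝓑) is a subring of ℝ^I (with pointwise operations) containing 𝓑; it is solid, i.e. if x ∈ ℝ^I, y ∈ ℝ_M(𝓑) and |x_ε| ≤ |y_ε| for all ε ∈ I then x ∈ ℝ_M(𝓑); it is asymptotically closed, i.e. ℝ_M(ℝ_M(𝓑)) = ℝ_M(𝓑); and it is minimal with these properties: every subring R of ℝ^I with 𝓑 ⊆ R and ℝ_M(R) = R satisfies ℝ_M(𝓑) ⊆ R. -/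
open MeasureTheory

/-- Strict order relation used in the paper: `x < y` iff `x ≤ y` and `x ≠ y`. -/
def sLT {I : Type*} [Preorder I] (x y : I) : Prop := x ≤ y ∧ x ≠ y

/-- A set of indices `𝕀 = (I, ≤, 𝓘)` in the sense of Giordano–Luperi Baglini. -/
structure SetOfIndices (I : Type*) [Preorder I] where
  sets : Set (Set I)
  empty_not_mem : (∅ : Set I) ∉ sets
  univ_mem : (Set.univ : Set I) ∈ sets
  inter_sub : ∀ A ∈ sets, ∀ B ∈ sets, ∃ C ∈ sets, C ⊆ A ∩ B
  downward : ∀ A ∈ sets, ∀ a ∈ A, ∀ e, e ≤ a →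
    ((∃ ε, ε ∈ A ∧ ε ≤ e) ∧
      (∀ b ∈ A, b ≤ e → ∀ c ∈ A, c ≤ e →
        ∃ d, d ∈ A ∧ d ≤ e ∧ sLT d b ∧ sLT d c))

section Defs

variable {I : Type*} [Preorder I]

/-- `x = O_{a,A}(y)`. -/
def BigOaA (A : Set I) (a : I) (x y : I → ℝ) : Prop :=
  ∃ H : ℝ, 0 < H ∧ ∃ ε₀, ε₀ ∈ A ∧ ε₀ ≤ a ∧ ∀ ε ∈ A, ε ≤ ε₀ → |x ε| ≤ H * |y ε|

/-- `x = O_𝒥(y)` for a family `𝒥` of subsets of `I`. -/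
def BigOJ (J : Set (Set I)) (x y : I → ℝ) : Prop :=
  ∃ A ∈ J, ∀ a ∈ A, BigOaA A a x y

/-- `x = O(y)` (i.e. `O_𝓘`). -/
def BigO (S : SetOfIndices I) (x y : I → ℝ) : Prop := BigOJ S.sets x y

/-- `i >_𝕀 j`. -/
def gtI (S : SetOfIndices I) (i j : I → ℝ) : Prop :=
  ∃ A ∈ S.sets, ∀ a ∈ A, ∃ e, e ∈ A ∧ e ≤ a ∧ ∀ ε ∈ A, ε ≤ e → j ε < i ε

/-- `P(ε)` holds for `ε` sufficiently small in `𝕀`. -/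
def EventuallyI (S : SetOfIndices I) (P : I → Prop) : Prop :=
  ∃ A ∈ S.sets, ∀ a ∈ A, ∃ e, e ∈ A ∧ e ≤ a ∧ ∀ ε ∈ A, ε ≤ e → P ε

/-- `lim_𝕀 f = l` for a finite limit `l ∈ ℝ`. -/
def limEq (S : SetOfIndices I) (f : I → ℝ) (l : ℝ) : Prop :=
  ∃ A ∈ S.sets, ∀ a ∈ A, ∀ r : ℝ, 0 < r →
    ∃ a₀, a₀ ≤ a ∧ ∀ ε ∈ A, ε ≤ a₀ → |l - f ε| < r

/-- `lim_𝕀 f = ∞` (unsigned infinity). -/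
def limInfinite (S : SetOfIndices I) (f : I → ℝ) : Prop :=
  ∃ A ∈ S.sets, ∀ a ∈ A, ∀ R : ℝ, 0 < R →
    ∃ a₀, a₀ ≤ a ∧ ∀ ε ∈ A, ε ≤ a₀ → R < |f ε|

/-- `lim_𝕀 f = +∞`. -/
def limPInf (S : SetOfIndices I) (f : I → ℝ) : Prop :=
  ∃ A ∈ S.sets, ∀ a ∈ A, ∀ R : ℝ, 0 < R →
    ∃ a₀, a₀ ≤ a ∧ ∀ ε ∈ A, ε ≤ a₀ → R < f ε

/-- `𝓑` is an asymptotic gauge on the set of indices `S`. -/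
structure IsAG (S : SetOfIndices I) (B : Set (I → ℝ)) : Prop where
  infinite : ∃ i ∈ B, limInfinite S i
  mul : ∀ i ∈ B, ∀ j ∈ B, ∃ p ∈ B, BigO S (fun ε => i ε * j ε) p
  smul : ∀ i ∈ B, ∀ r : ℝ, ∃ σ ∈ B, BigO S (fun ε => r * i ε) σ
  absAdd : ∀ i ∈ B, ∀ j ∈ B, ∃ s ∈ B, gtI S s (fun _ => 0) ∧
    BigO S (fun ε => |i ε| + |j ε|) s

/-- `𝓑_{>0}`, the positive part of `𝓑`. -/
def agPos (S : SetOfIndices I) (B : Set (I → ℝ)) : Set (I → ℝ) :=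
  {i ∈ B | gtI S i (fun _ => 0)}

/-- `ℝ_M(𝓑)`, the moderate nets generated by `𝓑`. -/
def RM (S : SetOfIndices I) (B : Set (I → ℝ)) : Set (I → ℝ) :=
  {x | ∃ b ∈ B, BigO S x b}

/-- `sup_{x ∈ K} |f x|`. -/
noncomputable def supAbsOn {X : Type*} (K : Set X) (f : X → ℝ) : ℝ :=
  sSup ((fun x => |f x|) '' K)

/-- Partial derivative of `f : ℝⁿ → ℝ` in the `i`-th coordinate direction. -/
noncomputable def pDeriv {n : ℕ} (i : Fin n) (f : (Fin n → ℝ) → ℝ) :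
    (Fin n → ℝ) → ℝ :=
  fun x => fderiv ℝ f x (Pi.single i 1)

/-- Iterated partial derivative `∂^α f` along a list of coordinate directions
(the list encodes the multi-index `α ∈ ℕⁿ`). -/
noncomputable def multiDeriv {n : ℕ} : List (Fin n) → ((Fin n → ℝ) → ℝ) → ((Fin n → ℝ) → ℝ)
  | [], f => f
  | i :: l, f => multiDeriv l (pDeriv i f)

/-- `ℰ_M(𝓑,Ω)`: the `𝓑`-moderate nets of smooth functions on `Ω ⊆ ℝⁿ`. -/
def EMod (S : SetOfIndices I) (B : Set (I → ℝ)) {n : ℕ} (Ω : Set (Fin n → ℝ))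
    (u : I → (Fin n → ℝ) → ℝ) : Prop :=
  ∀ K : Set (Fin n → ℝ), K ⊆ Ω → IsCompact K → ∀ l : List (Fin n),
    ∃ b ∈ B, BigO S (fun ε => supAbsOn K (multiDeriv l (u ε))) b

/-- `𝒩(𝒵,Ω)`: the `𝒵`-negligible nets of smooth functions on `Ω ⊆ ℝⁿ`. -/
def NNeg (S : SetOfIndices I) (Z : Set (I → ℝ)) {n : ℕ} (Ω : Set (Fin n → ℝ))
    (u : I → (Fin n → ℝ) → ℝ) : Prop :=
  ∀ K : Set (Fin n → ℝ), K ⊆ Ω → IsCompact K → ∀ l : List (Fin n),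
    ∀ z ∈ agPos S Z,
      BigO S (fun ε => supAbsOn K (multiDeriv l (u ε))) (fun ε => (z ε)⁻¹)

/-- One–dimensional version of `ℰ_M(𝓑,ℝ)`, using iterated derivatives. -/
def EM1 (S : SetOfIndices I) (B : Set (I → ℝ)) (u : I → ℝ → ℝ) : Prop :=
  ∀ K : Set ℝ, IsCompact K → ∀ k : ℕ,
    ∃ b ∈ B, BigO S (fun ε => supAbsOn K (iteratedDeriv k (u ε))) b

/-- One–dimensional version of `𝒩(𝒵,ℝ)`, using iterated derivatives. -/
def NEG1 (S : SetOfIndices I) (Z : Set (I → ℝ)) (u : I → ℝ → ℝ) : Prop :=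
  ∀ K : Set ℝ, IsCompact K → ∀ k : ℕ, ∀ z ∈ agPos S Z,
    BigO S (fun ε => supAbsOn K (iteratedDeriv k (u ε))) (fun ε => (z ε)⁻¹)

/-- `AG(b) = {b^m ∣ m ∈ ℕ}`, the principal asymptotic gauge generated by `b`. -/
def AGpow (b : I → ℝ) : Set (I → ℝ) := {g | ∃ m : ℕ, g = fun ε => (b ε) ^ m}

/-- `e^𝓑 = {e^{H·b} ∣ H > 0, b ∈ 𝓑}`, the exponential of the asymptotic gauge `𝓑`. -/
def expAG (B : Set (I → ℝ)) : Set (I → ℝ) :=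
  {g | ∃ H : ℝ, 0 < H ∧ ∃ b ∈ B, g = fun ε => Real.exp (H * b ε)}

end Defs

section BigOLemmas

variable {I : Type*} [Preorder I] {S : SetOfIndices I}

theorem BigO.of_abs_le {x y : I → ℝ} (h : ∀ ε, |x ε| ≤ |y ε|) : BigO S x y :=
  ⟨Set.univ, S.univ_mem, fun a _ =>
    ⟨1, one_pos, a, trivial, le_rfl, fun ε _ _ => by simpa using h ε⟩⟩

theorem BigO.refl (x : I → ℝ) : BigO S x x := .of_abs_le fun _ => le_rfl

/-- A bound that follows pointwise from two asymptotic bounds holds asymptotically. -/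
theorem BigO.combine {x y z b c d : I → ℝ} (hx : BigO S x b) (hy : BigO S y c)
    (h : ∀ H K : ℝ, 0 < H → 0 < K → ∃ L : ℝ, 0 < L ∧
      ∀ ε, |x ε| ≤ H * |b ε| → |y ε| ≤ K * |c ε| → |z ε| ≤ L * |d ε|) :
    BigO S z d := by
  obtain ⟨A, hA, hx⟩ := hx
  obtain ⟨B, hB, hy⟩ := hy
  obtain ⟨C, hC, hCAB⟩ := S.inter_sub A hA B hB
  refine ⟨C, hC, fun a ha => ?_⟩
  obtain ⟨H, hH, e₁, -, he₁a, hx⟩ := hx a (hCAB ha).1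
  obtain ⟨c₁, hc₁, hc₁e⟩ := (S.downward C hC a ha e₁ he₁a).1
  obtain ⟨K, hK, e₂, -, he₂c, hy⟩ := hy c₁ (hCAB hc₁).2
  obtain ⟨c₂, hc₂, hc₂e⟩ := (S.downward C hC c₁ hc₁ e₂ he₂c).1
  obtain ⟨L, hL, h⟩ := h H K hH hK
  have hc₂e₁ : c₂ ≤ e₁ := hc₂e.trans (he₂c.trans hc₁e)
  exact ⟨L, hL, c₂, hc₂, hc₂e₁.trans he₁a, fun ε hε hle =>
    h ε (hx ε (hCAB hε).1 (hle.trans hc₂e₁)) (hy ε (hCAB hε).2 (hle.trans hc₂e))⟩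

theorem BigO.trans {x y z : I → ℝ} (hxy : BigO S x y) (hyz : BigO S y z) : BigO S x z :=
  hxy.combine hyz fun H K hH hK => ⟨H * K, mul_pos hH hK, fun ε h₁ h₂ =>
    calc |x ε| ≤ H * |y ε| := h₁
      _ ≤ H * (K * |z ε|) := by gcongr
      _ = H * K * |z ε| := (mul_assoc _ _ _).symm⟩

theorem BigO.mul {x y b c : I → ℝ} (hx : BigO S x b) (hy : BigO S y c) :
    BigO S (x * y) (fun ε => b ε * c ε) :=
  hx.combine hy fun H K hH hK => ⟨H * K, mul_pos hH hK, fun ε h₁ h₂ =>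
    calc |(x * y) ε| = |x ε| * |y ε| := abs_mul _ _
      _ ≤ (H * |b ε|) * (K * |c ε|) := by gcongr
      _ = H * K * |b ε * c ε| := by rw [abs_mul]; ring⟩

theorem BigO.add {x y b c : I → ℝ} (hx : BigO S x b) (hy : BigO S y c) :
    BigO S (x + y) (fun ε => |b ε| + |c ε|) :=
  hx.combine hy fun H K hH hK => ⟨H + K, add_pos hH hK, fun ε h₁ h₂ => by
    have hxy : |(x + y) ε| ≤ |x ε| + |y ε| := abs_add_le _ _
    have hb := mul_nonneg hK.le (abs_nonneg (b ε))
    have hc := mul_nonneg hH.le (abs_nonneg (c ε))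
    rw [abs_of_nonneg (add_nonneg (abs_nonneg (b ε)) (abs_nonneg (c ε)))]
    linarith⟩

theorem limInfinite.one_bigO {i : I → ℝ} (hi : limInfinite S i) : BigO S 1 i := by
  obtain ⟨A, hA, h⟩ := hi
  refine ⟨A, hA, fun a ha => ?_⟩
  obtain ⟨a₀, ha₀, h⟩ := h a ha 1 one_pos
  obtain ⟨e, he, hea₀⟩ := (S.downward A hA a ha a₀ ha₀).1
  exact ⟨1, one_pos, e, he, hea₀.trans ha₀, fun ε hε hle => by
    simpa using (h ε hε (hle.trans hea₀)).le⟩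

theorem subset_RM (B : Set (I → ℝ)) : B ⊆ RM S B := fun b hb => ⟨b, hb, .refl b⟩

theorem mem_RM_of_bigO {B : Set (I → ℝ)} {x y : I → ℝ} (hy : y ∈ RM S B)
    (hxy : BigO S x y) : x ∈ RM S B :=
  let ⟨b, hb, hyb⟩ := hy
  ⟨b, hb, hxy.trans hyb⟩

theorem RM_mono {B C : Set (I → ℝ)} (h : B ⊆ C) : RM S B ⊆ RM S C :=
  fun _ ⟨b, hb, hx⟩ => ⟨b, h hb, hx⟩

/-- The ring of moderate nets generated by an asymptotic gauge. -/
def IsAG.subring {B : Set (I → ℝ)} (hB : IsAG S B) : Subring (I → ℝ) where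
  carrier := RM S B
  one_mem' := let ⟨i, hi, hlim⟩ := hB.infinite; ⟨i, hi, hlim.one_bigO⟩
  zero_mem' := let ⟨i, hi, _⟩ := hB.infinite; ⟨i, hi, .of_abs_le fun ε => by simp⟩
  mul_mem' := fun ⟨b, hb, hx⟩ ⟨c, hc, hy⟩ =>
    let ⟨p, hp, h⟩ := hB.mul b hb c hc
    ⟨p, hp, (hx.mul hy).trans h⟩
  add_mem' := fun ⟨b, hb, hx⟩ ⟨c, hc, hy⟩ =>
    let ⟨s, hs, _, h⟩ := hB.absAdd b hb c hc
    ⟨s, hs, (hx.add hy).trans h⟩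
  neg_mem' := fun hx => mem_RM_of_bigO hx (.of_abs_le fun ε => by simp)

end BigOLemmas

/-- `ℝ_M(𝓑)` is the minimal asymptotically closed solid subring of
`ℝ^I` containing `𝓑` (Thm. `acr` of the paper). -/
theorem RM_minimal_solid_ring {I : Type*} [Preorder I] (S : SetOfIndices I)
    (B : Set (I → ℝ)) (hB : IsAG S B) :
    B ⊆ RM S B ∧
    (∃ R : Subring (I → ℝ), (R : Set (I → ℝ)) = RM S B) ∧
    (∀ x : I → ℝ, ∀ y ∈ RM S B, (∀ ε, |x ε| ≤ |y ε|) → x ∈ RM S B) ∧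
    RM S (RM S B) = RM S B ∧
    (∀ R : Subring (I → ℝ), B ⊆ (R : Set (I → ℝ)) →
      RM S (R : Set (I → ℝ)) = (R : Set (I → ℝ)) →
      RM S B ⊆ (R : Set (I → ℝ))) := by
  refine ⟨subset_RM B, ⟨hB.subring, rfl⟩,
    fun x y hy hxy => mem_RM_of_bigO hy (.of_abs_le hxy), ?_,
    fun R hBR hR => (RM_mono hBR).trans hR.subset⟩
  exact Set.Subset.antisymm (fun x ⟨y, hy, hxy⟩ => mem_RM_of_bigO hy hxy) (subset_RM _)
end

section
/- Let 𝕀 = (I, ≤, 𝓘) be a set of indices, let 𝓑, 𝒵 be asymptotic gauges on 𝕀 with ℝ_M(𝓑) ⊆ ℝ_M(𝒵), and let Ω ⊆ ℝⁿ be an open set. Then 𝒩(𝒵,Ω) is a multiplicative ideal of ℰ_M(𝓑,Ω): for every u ∈ 𝒩(𝒵,Ω) and every v ∈ ℰ_M(𝓑,Ω), the pointwise product net (u_ε·v_ε)_ε belongs to 𝒩(𝒵,Ω). -/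
open MeasureTheory

section Helpers

open Set

/-- `P H ε` holds for `ε` sufficiently small, where the constant `H > 0` may depend on the
base point: the common shape of `BigO` and `gtI`. -/
def EventuallyBdd {I : Type*} [Preorder I] (S : SetOfIndices I) (P : ℝ → I → Prop) : Prop :=
  ∃ A ∈ S.sets, ∀ a ∈ A, ∃ H : ℝ, 0 < H ∧ ∃ e, e ∈ A ∧ e ≤ a ∧ ∀ ε ∈ A, ε ≤ e → P H ε

variable {I : Type*} [Preorder I] {S : SetOfIndices I}

theorem EventuallyBdd.combine {P Q R : ℝ → I → Prop} (hP : EventuallyBdd S P)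
    (hQ : EventuallyBdd S Q)
    (h : ∀ H, 0 < H → ∀ H', 0 < H' → ∃ L, 0 < L ∧ ∀ ε, P H ε → Q H' ε → R L ε) :
    EventuallyBdd S R := by
  obtain ⟨A, hA, hPA⟩ := hP
  obtain ⟨B, hB, hQB⟩ := hQ
  obtain ⟨C, hC, hCAB⟩ := S.inter_sub A hA B hB
  refine ⟨C, hC, fun a ha => ?_⟩
  obtain ⟨H, hH, e, -, hea, hP⟩ := hPA a (hCAB ha).1
  obtain ⟨⟨c, hc, hce⟩, -⟩ := S.downward C hC a ha e hea
  obtain ⟨H', hH', e', -, hec, hQ⟩ := hQB c (hCAB hc).2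
  obtain ⟨⟨d, hd, hde⟩, -⟩ := S.downward C hC c hc e' hec
  obtain ⟨L, hL, hR⟩ := h H hH H' hH'
  exact ⟨L, hL, d, hd, hde.trans (hec.trans (hce.trans hea)), fun ε hε hεd =>
    hR ε (hP ε (hCAB hε).1 (hεd.trans (hde.trans (hec.trans hce))))
      (hQ ε (hCAB hε).2 (hεd.trans hde))⟩

theorem gtI.eventuallyBdd {i j : I → ℝ} (h : gtI S i j) :
    EventuallyBdd S (fun _ ε => j ε < i ε) := by
  obtain ⟨A, hA, h⟩ := h
  exact ⟨A, hA, fun a ha => ⟨1, one_pos, h a ha⟩⟩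

theorem BigO.eventuallyBdd {x y : I → ℝ} (h : BigO S x y) :
    EventuallyBdd S (fun H ε => |x ε| ≤ H * |y ε|) := h

theorem BigO.of_abs_le_add {x x' w y : I → ℝ} (h : BigO S x y) (h' : BigO S x' y)
    (hw : ∀ ε, |w ε| ≤ |x ε| + |x' ε|) : BigO S w y :=
  EventuallyBdd.combine h.eventuallyBdd h'.eventuallyBdd fun H hH H' hH' =>
    ⟨H + H', by positivity, fun ε h₁ h₂ => by linarith [hw ε]⟩

/-- A positive gauge element dominates the product of two gauge elements. -/
theorem IsAG.exists_agPos_mul {Z : Set (I → ℝ)} (hZ : IsAG S Z) {i j : I → ℝ} (hi : i ∈ Z)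
    (hj : j ∈ Z) : ∃ s ∈ agPos S Z, BigO S (fun ε => i ε * j ε) s := by
  obtain ⟨p, hp, hijp⟩ := hZ.mul i hi j hj
  obtain ⟨s, hs, hs0, hps⟩ := hZ.absAdd p hp p hp
  refine ⟨s, ⟨hs, hs0⟩, hijp.eventuallyBdd.combine hps.eventuallyBdd fun H hH H' hH' =>
    ⟨H * H', by positivity, fun ε h₁ h₂ => h₁.trans ?_⟩⟩
  rw [mul_assoc]
  refine mul_le_mul_of_nonneg_left (le_trans ?_ h₂) hH.le
  exact (le_add_of_nonneg_right (abs_nonneg (p ε))).trans (le_abs_self _)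

/-- If `x` is `𝒵`-negligible and `y` is `𝒵`-moderate, then `x * y` is `𝒵`-negligible. -/
theorem BigO.mul_inv_of_mem_RM {Z : Set (I → ℝ)} (hZ : IsAG S Z) {x y w : I → ℝ}
    (hx : ∀ z ∈ agPos S Z, BigO S x (fun ε => (z ε)⁻¹)) (hy : y ∈ RM S Z)
    (hw : ∀ ε, |w ε| ≤ |x ε| * |y ε|) {z : I → ℝ} (hz : z ∈ agPos S Z) :
    BigO S w (fun ε => (z ε)⁻¹) := by
  obtain ⟨ζ, hζ, hyζ⟩ := hy
  obtain ⟨s, hs, hzs⟩ := hZ.exists_agPos_mul hz.1 hζ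
  have hpos : EventuallyBdd S (fun _ ε => 0 < z ε ∧ 0 < s ε) :=
    hz.2.eventuallyBdd.combine hs.2.eventuallyBdd fun _ _ _ _ =>
      ⟨1, one_pos, fun _ h₁ h₂ => ⟨h₁, h₂⟩⟩
  have hζs : EventuallyBdd S (fun H ε => 0 < z ε ∧ 0 < s ε ∧ |ζ ε| ≤ H * (s ε * (z ε)⁻¹)) := by
    refine hpos.combine hzs.eventuallyBdd fun _ _ H hH =>
      ⟨H, hH, fun ε ⟨h₁, h₂⟩ h₃ => ⟨h₁, h₂, ?_⟩⟩
    rw [abs_mul, abs_of_pos h₁, abs_of_pos h₂] at h₃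
    rw [← mul_assoc, ← div_eq_mul_inv, le_div_iff₀ h₁]
    linarith
  have hys : EventuallyBdd S
      (fun H ε => 0 < z ε ∧ 0 < s ε ∧ |y ε| ≤ H * (s ε * (z ε)⁻¹)) :=
    hyζ.eventuallyBdd.combine hζs fun H hH H' hH' =>
      ⟨H * H', by positivity, fun ε h₁ ⟨h₂, h₃, h₄⟩ => ⟨h₂, h₃, h₁.trans <| by
        rw [mul_assoc]; exact mul_le_mul_of_nonneg_left h₄ hH.le⟩⟩
  refine (hx s hs).eventuallyBdd.combine hys fun H hH H' hH' =>
    ⟨H * H', by positivity, fun ε h₁ ⟨h₂, h₃, h₄⟩ => (hw ε).trans ?_⟩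
  rw [abs_of_pos (inv_pos.2 h₃)] at h₁
  rw [abs_of_pos (inv_pos.2 h₂)]
  calc |x ε| * |y ε| ≤ (H * (s ε)⁻¹) * (H' * (s ε * (z ε)⁻¹)) :=
        mul_le_mul h₁ h₄ (abs_nonneg _) (by positivity)
    _ = H * H' * (z ε)⁻¹ := by field_simp

section Sup

variable {X : Type*} {K : Set X} {f g h : X → ℝ}

theorem supAbsOn_nonneg (K : Set X) (f : X → ℝ) : 0 ≤ supAbsOn K f :=
  Real.sSup_nonneg (by rintro _ ⟨x, -, rfl⟩; exact abs_nonneg _)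

theorem supAbsOn_congr (hfg : EqOn f g K) : supAbsOn K f = supAbsOn K g :=
  congrArg sSup (image_congr fun _ hx => congrArg abs (hfg hx))

theorem supAbsOn_le {c : ℝ} (hc : 0 ≤ c) (hf : ∀ x ∈ K, |f x| ≤ c) : supAbsOn K f ≤ c :=
  Real.sSup_le (by rintro _ ⟨x, hx, rfl⟩; exact hf x hx) hc

theorem abs_le_supAbsOn [TopologicalSpace X] (hK : IsCompact K) (hf : ContinuousOn f K) {x : X}
    (hx : x ∈ K) : |f x| ≤ supAbsOn K f :=
  le_csSup (hK.bddAbove_image hf.abs) ⟨x, hx, rfl⟩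

theorem supAbsOn_add_le [TopologicalSpace X] (hK : IsCompact K) (hf : ContinuousOn f K)
    (hg : ContinuousOn g K) :
    supAbsOn K (fun x => f x + g x) ≤ supAbsOn K f + supAbsOn K g :=
  supAbsOn_le (add_nonneg (supAbsOn_nonneg K f) (supAbsOn_nonneg K g)) fun x hx =>
    (abs_add_le _ _).trans
      (add_le_add (abs_le_supAbsOn hK hf hx) (abs_le_supAbsOn hK hg hx))

theorem supAbsOn_mul_le [TopologicalSpace X] (hK : IsCompact K) (hf : ContinuousOn f K)
    (hg : ContinuousOn g K) :
    supAbsOn K (fun x => f x * g x) ≤ supAbsOn K f * supAbsOn K g :=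
  supAbsOn_le (mul_nonneg (supAbsOn_nonneg K f) (supAbsOn_nonneg K g)) fun x hx => by
    rw [abs_mul]
    exact mul_le_mul (abs_le_supAbsOn hK hf hx) (abs_le_supAbsOn hK hg hx) (abs_nonneg _)
      (supAbsOn_nonneg K f)

end Sup

section Deriv

variable {n : ℕ} {Ω : Set (Fin n → ℝ)} {f g : (Fin n → ℝ) → ℝ}

theorem ContDiffOn.differentiableAt_of_isOpen (hΩ : IsOpen Ω)
    (hf : ContDiffOn ℝ (⊤ : ℕ∞) f Ω) {x : Fin n → ℝ} (hx : x ∈ Ω) : DifferentiableAt ℝ f x :=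
  (hf.differentiableOn (by simp)).differentiableAt (hΩ.mem_nhds hx)

theorem ContDiffOn.pDeriv (hΩ : IsOpen Ω) (hf : ContDiffOn ℝ (⊤ : ℕ∞) f Ω) (i : Fin n) :
    ContDiffOn ℝ (⊤ : ℕ∞) (pDeriv i f) Ω :=
  (hf.fderiv_of_isOpen hΩ (by simp)).clm_apply contDiffOn_const

theorem ContDiffOn.multiDeriv (hΩ : IsOpen Ω) (l : List (Fin n))
    (hf : ContDiffOn ℝ (⊤ : ℕ∞) f Ω) : ContDiffOn ℝ (⊤ : ℕ∞) (multiDeriv l f) Ω := by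
  induction l generalizing f with
  | nil => exact hf
  | cons i l ih => exact ih (hf.pDeriv hΩ i)

theorem pDeriv_congr (hΩ : IsOpen Ω) (hfg : EqOn f g Ω) (i : Fin n) :
    EqOn (pDeriv i f) (pDeriv i g) Ω := fun x hx => by
  simp only [pDeriv, (hfg.eventuallyEq_of_mem (hΩ.mem_nhds hx)).fderiv_eq]

theorem multiDeriv_congr (hΩ : IsOpen Ω) (l : List (Fin n)) (hfg : EqOn f g Ω) :
    EqOn (multiDeriv l f) (multiDeriv l g) Ω := by
  induction l generalizing f g with
  | nil => exact hfg
  | cons i l ih => exact ih (pDeriv_congr hΩ hfg i)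

theorem pDeriv_add (hΩ : IsOpen Ω) (hf : ContDiffOn ℝ (⊤ : ℕ∞) f Ω)
    (hg : ContDiffOn ℝ (⊤ : ℕ∞) g Ω) (i : Fin n) :
    EqOn (pDeriv i fun x => f x + g x) (fun x => pDeriv i f x + pDeriv i g x) Ω :=
  fun x hx => by
    simp only [pDeriv]
    rw [fderiv_fun_add (hf.differentiableAt_of_isOpen hΩ hx)
      (hg.differentiableAt_of_isOpen hΩ hx)]
    rfl

theorem pDeriv_mul (hΩ : IsOpen Ω) (hf : ContDiffOn ℝ (⊤ : ℕ∞) f Ω)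
    (hg : ContDiffOn ℝ (⊤ : ℕ∞) g Ω) (i : Fin n) :
    EqOn (pDeriv i fun x => f x * g x) (fun x => pDeriv i f x * g x + f x * pDeriv i g x) Ω :=
  fun x hx => by
    simp only [pDeriv]
    rw [fderiv_fun_mul (hf.differentiableAt_of_isOpen hΩ hx)
      (hg.differentiableAt_of_isOpen hΩ hx)]
    simp only [add_apply, smul_apply, smul_eq_mul]
    ring

theorem multiDeriv_add (hΩ : IsOpen Ω) (l : List (Fin n)) (hf : ContDiffOn ℝ (⊤ : ℕ∞) f Ω)
    (hg : ContDiffOn ℝ (⊤ : ℕ∞) g Ω) :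
    EqOn (multiDeriv l fun x => f x + g x) (fun x => multiDeriv l f x + multiDeriv l g x) Ω := by
  induction l generalizing f g with
  | nil => exact fun _ _ => rfl
  | cons i l ih =>
    exact (multiDeriv_congr hΩ l (pDeriv_add hΩ hf hg i)).trans
      (ih (hf.pDeriv hΩ i) (hg.pDeriv hΩ i))

theorem multiDeriv_cons_mul (hΩ : IsOpen Ω) (i : Fin n) (l : List (Fin n))
    (hf : ContDiffOn ℝ (⊤ : ℕ∞) f Ω) (hg : ContDiffOn ℝ (⊤ : ℕ∞) g Ω) :
    EqOn (multiDeriv (i :: l) fun x => f x * g x)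
      (fun x => multiDeriv l (fun y => pDeriv i f y * g y) x +
        multiDeriv l (fun y => f y * pDeriv i g y) x) Ω :=
  (multiDeriv_congr hΩ l (pDeriv_mul hΩ hf hg i)).trans
    (multiDeriv_add hΩ l ((hf.pDeriv hΩ i).mul hg) (hf.mul (hg.pDeriv hΩ i)))

theorem NNeg.pDeriv {Z : Set (I → ℝ)} {u : I → (Fin n → ℝ) → ℝ} (hu : NNeg S Z Ω u)
    (i : Fin n) : NNeg S Z Ω (fun ε => pDeriv i (u ε)) :=
  fun K hKΩ hK l => hu K hKΩ hK (i :: l)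

theorem EMod.pDeriv {B : Set (I → ℝ)} {v : I → (Fin n → ℝ) → ℝ} (hv : EMod S B Ω v)
    (i : Fin n) : EMod S B Ω (fun ε => pDeriv i (v ε)) :=
  fun K hKΩ hK l => hv K hKΩ hK (i :: l)

end Deriv

end Helpers

/-- if `ℝ_M(𝓑) ⊆ ℝ_M(𝒵)` then `𝒩(𝒵,Ω)` is a multiplicative ideal
of `ℰ_M(𝓑,Ω)` (Thm. `equivCondForIdeal`, (ii) ⇒ (iii), of the paper). -/
theorem negligible_is_ideal {I : Type*} [Preorder I] (S : SetOfIndices I)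
    {n : ℕ} (B Z : Set (I → ℝ)) (hB : IsAG S B) (hZ : IsAG S Z)
    (hsub : RM S B ⊆ RM S Z)
    (Ω : Set (Fin n → ℝ)) (hΩ : IsOpen Ω)
    (u v : I → (Fin n → ℝ) → ℝ)
    (hu : ∀ ε, ContDiffOn ℝ (⊤ : ℕ∞) (u ε) Ω) (hv : ∀ ε, ContDiffOn ℝ (⊤ : ℕ∞) (v ε) Ω)
    (hun : NNeg S Z Ω u) (hvm : EMod S B Ω v) :
    NNeg S Z Ω (fun ε x => u ε x * v ε x) := by
  intro K hKΩ hK l z hz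
  induction l generalizing u v with
  | nil =>
    have hvZ := hsub (hvm K hKΩ hK [])
    refine BigO.mul_inv_of_mem_RM hZ (hun K hKΩ hK []) hvZ (fun ε => ?_) hz
    rw [abs_of_nonneg (supAbsOn_nonneg _ _), abs_of_nonneg (supAbsOn_nonneg _ _),
      abs_of_nonneg (supAbsOn_nonneg _ _)]
    exact supAbsOn_mul_le hK ((hu ε).continuousOn.mono hKΩ) ((hv ε).continuousOn.mono hKΩ)
  | cons i l ih =>
    have hu' := fun ε => (hu ε).pDeriv hΩ i
    have hv' := fun ε => (hv ε).pDeriv hΩ i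
    refine BigO.of_abs_le_add (ih _ v hu' hv (hun.pDeriv i) hvm)
      (ih u _ hu hv' hun (hvm.pDeriv i)) fun ε => ?_
    rw [supAbsOn_congr ((multiDeriv_cons_mul hΩ i l (hu ε) (hv ε)).mono hKΩ),
      abs_of_nonneg (supAbsOn_nonneg _ _), abs_of_nonneg (supAbsOn_nonneg _ _),
      abs_of_nonneg (supAbsOn_nonneg _ _)]
    exact supAbsOn_add_le hK
      ((((hu' ε).mul (hv ε)).multiDeriv hΩ l).continuousOn.mono hKΩ)
      ((((hu ε).mul (hv' ε)).multiDeriv hΩ l).continuousOn.mono hKΩ)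
end
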